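/- For every string T[1..n] and every bound c ≥ 0, the Greedy BAT-LZ procedure — starting at i = 1 and repeatedly taking as the next phrase the longest valid prefix T[i..i+ℓ−1] of T[i..] together with a witnessing source and the next explicit character T[i+ℓ] — terminates after at most n phrases and yields a leftward parse of T whose chain-length array satisfies C[j] ≤ c for all 1 ≤ j ≤ n, i.e., a BAT-LZ parse of T with parameter c. -/

import Mathlib

/-- A phrase of a leftward parse: a copied part of length `len`
(whose source starts at 0-based position `src`; `src` is only meaningful when
`len > 0`), followed by one explicit character. -/
structure Phrase where
  len : ℕ
  src : ℕ

/-- Starting position (0-based) of the `k`-th phrase of the parse `P`. -/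
def phraseStart (P : List Phrase) (k : ℕ) : ℕ :=
  ((P.take k).map (fun p => p.len + 1)).sum

/-- `P` is a leftward parse of the length-`n` string `T` (0-based positions):
the phrases cover `T`, and every phrase with a nonempty copied part has a source
occurrence starting strictly before the phrase and matching it. -/
def IsLeftwardParse {α : Type*} (n : ℕ) (T : ℕ → α) (P : List Phrase) : Prop :=
  ((P.map (fun p => p.len + 1)).sum = n) ∧
  ∀ k (hk : k < P.length),
    0 < (P.get ⟨k, hk⟩).len →
      (P.get ⟨k, hk⟩).src < phraseStart P k ∧
      ∀ l < (P.get ⟨k, hk⟩).len,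
        T ((P.get ⟨k, hk⟩).src + l) = T (phraseStart P k + l)

/-- `C` satisfies the chain-length recurrences for the parse `P`:
the explicit final position of each phrase has chain length `0`; a copied
position takes the chain length of its source position plus one; and in the
overlapping case the chain lengths repeat with the period of the overlap. -/
def ChainSpec (P : List Phrase) (C : ℕ → ℕ) : Prop :=
  ∀ k (hk : k < P.length),
    C (phraseStart P k + (P.get ⟨k, hk⟩).len) = 0 ∧
    ∀ l < (P.get ⟨k, hk⟩).len,
      if l < phraseStart P k - (P.get ⟨k, hk⟩).src then
        C (phraseStart P k + l) = C ((P.get ⟨k, hk⟩).src + l) + 1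
      else
        C (phraseStart P k + l) =
          C (phraseStart P k + l % (phraseStart P k - (P.get ⟨k, hk⟩).src))

/-- The prefix of length `ℓ` of `T[i..]` is valid (w.r.t. chain lengths `C`
of the already parsed prefix `T[0..i-1]` and the bound `c`): it is empty, or it
has a source occurrence starting before `i` all of whose non-overlapping
positions have chain length strictly below `c`. -/
def ValidPrefix {α : Type*} (T : ℕ → α) (C : ℕ → ℕ) (i c ℓ : ℕ) : Prop :=
  ℓ = 0 ∨ ∃ s < i, (∀ l < ℓ, T (s + l) = T (i + l)) ∧
    ∀ m < min ℓ (i - s), C (s + m) < c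

/-- `p` is a greedy phrase starting at position `i`, and `C` satisfies the chain-length recurrence
on it. -/
structure IsGreedyPhrase {α : Type*} (n : ℕ) (T : ℕ → α) (c : ℕ) (C : ℕ → ℕ) (i : ℕ)
    (p : Phrase) : Prop where
  source : 0 < p.len → p.src < i ∧ ∀ l < p.len, T (p.src + l) = T (i + l)
  chain_explicit : C (i + p.len) = 0
  chain_copied : ∀ l < p.len, if l < i - p.src then C (i + l) = C (p.src + l) + 1
    else C (i + l) = C (i + l % (i - p.src))
  chain_lt : 0 < p.len → ∀ m < min p.len (i - p.src), C (p.src + m) < c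
  longest : ∀ ℓ', i + ℓ' < n → ValidPrefix T C i c ℓ' → ℓ' ≤ p.len

theorem ValidPrefix.congr {α : Type*} {T : ℕ → α} {C C' : ℕ → ℕ} {i c ℓ : ℕ}
    (hC : ∀ j < i, C' j = C j) (h : ValidPrefix T C i c ℓ) : ValidPrefix T C' i c ℓ := by
  rcases h with h | ⟨s, hs, hT, hlt⟩
  · exact Or.inl h
  · refine Or.inr ⟨s, hs, hT, fun m hm => ?_⟩
    rw [hC _ (by omega)]
    exact hlt m hm

/-- Being a greedy phrase depends on `C` only up to the end of the phrase. -/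
theorem IsGreedyPhrase.congr {α : Type*} {n : ℕ} {T : ℕ → α} {c : ℕ} {C C' : ℕ → ℕ} {i : ℕ}
    {p : Phrase} (h : IsGreedyPhrase n T c C i p) (hC : ∀ j < i + (p.len + 1), C' j = C j) :
    IsGreedyPhrase n T c C' i p where
  source := h.source
  chain_explicit := by rw [hC _ (by omega)]; exact h.chain_explicit
  chain_copied l hl := by
    have hs := (h.source (by omega)).1
    have hl' := h.chain_copied l hl
    have hmod := Nat.mod_le l (i - p.src)
    split_ifs with hlt
    · rw [if_pos hlt] at hl'
      rwa [hC _ (by omega), hC _ (by omega)]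
    · rw [if_neg hlt] at hl'
      rwa [hC _ (by omega), hC _ (by omega)]
  chain_lt hpos m hm := by
    rw [hC _ (by omega)]
    exact h.chain_lt hpos m hm
  longest ℓ' hℓ' hv := h.longest ℓ' hℓ' (hv.congr fun j hj => (hC j (by omega)).symm)

/-- One step of the greedy procedure: a greedy phrase exists at every position `i < n`, and the
chain lengths extend to it without exceeding `c`. -/
theorem exists_isGreedyPhrase {α : Type*} {n : ℕ} (T : ℕ → α) {c : ℕ} {C : ℕ → ℕ} {i : ℕ}
    (hi : i < n) (hC : ∀ j < i, C j ≤ c) :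
    ∃ (p : Phrase) (C' : ℕ → ℕ), i + (p.len + 1) ≤ n ∧ (∀ j < i, C' j = C j) ∧
      (∀ j, C' j ≤ c) ∧ IsGreedyPhrase n T c C' i p := by
  classical
  obtain ⟨ℓ, hℓn, hℓ, hmax⟩ : ∃ ℓ, i + ℓ < n ∧ ValidPrefix T C i c ℓ ∧
      ∀ ℓ', i + ℓ' < n → ValidPrefix T C i c ℓ' → ℓ' ≤ ℓ := by
    refine ⟨Nat.findGreatest (ValidPrefix T C i c) (n - 1 - i), ?_,
      Nat.findGreatest_spec (Nat.zero_le _) (Or.inl rfl),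
      fun ℓ' hℓ' hv => Nat.le_findGreatest (by omega) hv⟩
    have := Nat.findGreatest_le (P := ValidPrefix T C i c) (n - 1 - i)
    omega
  obtain ⟨s, hs⟩ : ∃ s, 0 < ℓ → s < i ∧ (∀ l < ℓ, T (s + l) = T (i + l)) ∧
      ∀ m < min ℓ (i - s), C (s + m) < c := by
    rcases hℓ with h | ⟨s, hs⟩
    · exact ⟨0, by omega⟩
    · exact ⟨s, fun _ => hs⟩
  let C' : ℕ → ℕ := fun j =>
    if j < i then C j else if j < i + ℓ then C (s + (j - i) % (i - s)) + 1 else 0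
  have hlow : ∀ j < i, C' j = C j := fun j hj => if_pos hj
  have hcopy : ∀ l < ℓ, C' (i + l) = C (s + l % (i - s)) + 1 := fun l hl => by
    simp [C', hl]
  refine ⟨⟨ℓ, s⟩, C', by simp only; omega, hlow, fun j => ?_, ?_⟩
  · by_cases hji : j < i
    · rw [hlow j hji]; exact hC j hji
    by_cases hjl : j < i + ℓ
    · obtain ⟨l, rfl⟩ := Nat.exists_eq_add_of_le (not_lt.1 hji)
      obtain ⟨hsi, -, hlt⟩ := hs (by omega)
      rw [hcopy l (by omega)]
      have h1 := Nat.mod_le l (i - s)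
      have h2 := Nat.mod_lt l (show 0 < i - s by omega)
      exact hlt _ (by omega)
    · simp [C', hji, hjl]
  · refine ⟨fun hpos => ⟨(hs hpos).1, (hs hpos).2.1⟩, by simp [C'], fun l hl => ?_,
      fun hpos m hm => ?_, fun ℓ' hℓ' hv => hmax ℓ' hℓ' (hv.congr fun j hj => (hlow j hj).symm)⟩
    · simp only at hl ⊢
      have hmod := Nat.mod_le l (i - s)
      split_ifs with hlt
      · rw [hcopy l hl, Nat.mod_eq_of_lt hlt, hlow _ (by omega)]
      · rw [hcopy l hl, hcopy _ (by omega), Nat.mod_mod]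
    · simp only at hm hpos ⊢
      rw [hlow _ (by omega)]
      exact (hs hpos).2.2 m hm

theorem phraseStart_append_of_le {P : List Phrase} {k : ℕ} (Q : List Phrase) (hk : k ≤ P.length) :
    phraseStart (P ++ Q) k = phraseStart P k := by
  rw [phraseStart, List.take_append_of_le_length hk, phraseStart]

theorem phraseStart_length (P : List Phrase) :
    phraseStart P P.length = (P.map (fun p => p.len + 1)).sum := by
  rw [phraseStart, List.take_length]

theorem phraseStart_succ {P : List Phrase} {k : ℕ} (hk : k < P.length) :
    phraseStart P (k + 1) = phraseStart P k + (P[k].len + 1) := by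
  simp only [phraseStart, List.take_succ_eq_append_getElem hk, List.map_append, List.sum_append,
    List.map_singleton, List.sum_singleton]

theorem phraseStart_mono (P : List Phrase) : Monotone (phraseStart P) := by
  refine monotone_nat_of_le_succ fun k => ?_
  by_cases hk : k < P.length
  · rw [phraseStart_succ hk]; omega
  · simp [phraseStart, List.take_of_length_le (not_lt.1 hk),
      List.take_of_length_le (show P.length ≤ k + 1 by omega)]

theorem length_le_sum_len (P : List Phrase) :
    P.length ≤ (P.map (fun p => p.len + 1)).sum := by
  induction P with
  | nil => simp
  | cons p P ih => simp only [List.length_cons, List.map_cons, List.sum_cons]; omega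

/-- Every greedy parse of the prefix of length `phraseStart P P.length` extends to one of the
whole string. -/
theorem exists_greedy_extension {α : Type*} {n : ℕ} (T : ℕ → α) {c : ℕ} (P : List Phrase)
    (C : ℕ → ℕ) (hn : phraseStart P P.length ≤ n) (hC : ∀ j, C j ≤ c)
    (hP : ∀ k (hk : k < P.length), IsGreedyPhrase n T c C (phraseStart P k) P[k]) :
    ∃ (Q : List Phrase) (D : ℕ → ℕ), phraseStart Q Q.length = n ∧ (∀ j, D j ≤ c) ∧
      ∀ k (hk : k < Q.length), IsGreedyPhrase n T c D (phraseStart Q k) Q[k] := by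
  rcases hn.eq_or_lt with h | h
  · exact ⟨P, C, h, hC, hP⟩
  · obtain ⟨p, C', hpn, hlow, hC', hp⟩ := exists_isGreedyPhrase T h fun j _ => hC j
    have hend : phraseStart (P ++ [p]) (P ++ [p]).length =
        phraseStart P P.length + (p.len + 1) := by
      simp only [phraseStart_length, List.map_append, List.sum_append, List.map_singleton,
        List.sum_singleton]
    refine exists_greedy_extension T (P ++ [p]) C' (hend ▸ hpn) hC' fun k hk => ?_
    rw [List.length_append, List.length_singleton] at hk
    rw [phraseStart_append_of_le _ (by omega)]
    rcases (Nat.lt_succ_iff.1 hk).eq_or_lt with rfl | hk'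
    · simpa using hp
    · rw [List.getElem_append_left hk']
      refine (hP k hk').congr fun j hj => hlow j ?_
      rw [← phraseStart_succ hk'] at hj
      exact hj.trans_le (phraseStart_mono P hk')
termination_by n - phraseStart P P.length
decreasing_by omega

/-- The Greedy BAT-LZ procedure terminates after at most `n` phrases and
yields a BAT-LZ parse of `T` with parameter `c`: a leftward parse, each of
whose phrases is a longest valid prefix (whose chosen source witnesses its
validity), with all chain lengths bounded by `c`. -/
theorem greedy_batlz_exists {α : Type*} (n : ℕ) (T : ℕ → α) (c : ℕ) :
    ∃ (P : List Phrase) (C : ℕ → ℕ),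
      IsLeftwardParse n T P ∧ ChainSpec P C ∧ P.length ≤ n ∧
      (∀ j < n, C j ≤ c) ∧
      (∀ k (hk : k < P.length),
        (0 < (P.get ⟨k, hk⟩).len →
          ∀ m < min (P.get ⟨k, hk⟩).len (phraseStart P k - (P.get ⟨k, hk⟩).src),
            C ((P.get ⟨k, hk⟩).src + m) < c) ∧
        (∀ ℓ', phraseStart P k + ℓ' < n →
          ValidPrefix T C (phraseStart P k) c ℓ' → ℓ' ≤ (P.get ⟨k, hk⟩).len)) := by
  obtain ⟨P, C, hn, hC, hP⟩ := exists_greedy_extension (n := n) T (c := c) [] (fun _ => 0)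
    (by simp [phraseStart]) (by simp) (by simp)
  rw [phraseStart_length] at hn
  exact ⟨P, C, ⟨hn, fun k hk => (hP k hk).source⟩,
    fun k hk => ⟨(hP k hk).chain_explicit, (hP k hk).chain_copied⟩,
    hn ▸ length_le_sum_len P, fun j _ => hC j,
    fun k hk => ⟨(hP k hk).chain_lt, (hP k hk).longest⟩⟩
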